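/- Let Ψ ∈ ℝ^{d1d2×d1d2} be a matrix whose entry Ψ[d2(r−1)+v, d2(s−1)+w] (for 1 ≤ r,s ≤ d1, 1 ≤ v,w ≤ d2) is zero unless r > s and v > w. Then for every A ∈ ℝ^{d1×d1} and B ∈ ℝ^{d2×d2}, ‖Ψ − ⌊A⌋ ⊗ ⌊B⌋‖_F ≤ ‖Ψ − A ⊗ B‖_F. Consequently, the minimum of ‖Ψ − A ⊗ B‖_F over all pairs (A, B) is attained at a pair of strictly lower triangular matrices. -/

import Mathlib

open Matrix
open scoped Kronecker

/-- The strictly lower triangular part `⌊M⌋` of a `Fin d`-indexed square matrix. -/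
def slt {d : ℕ} (M : Matrix (Fin d) (Fin d) ℝ) : Matrix (Fin d) (Fin d) ℝ :=
  fun i j => if j < i then M i j else 0

/-- A strictly lower triangular matrix: zero on and above the diagonal. -/
def IsStrictLower {d : ℕ} (M : Matrix (Fin d) (Fin d) ℝ) : Prop :=
  ∀ i j : Fin d, i ≤ j → M i j = 0

/-- The squared Frobenius norm `‖M‖_F² = Σ_{i,j} M[i,j]²`. -/
def frobSq {ι κ : Type*} [Fintype ι] [Fintype κ] (M : Matrix ι κ ℝ) : ℝ :=
  ∑ i, ∑ j, (M i j) ^ 2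

lemma frobSq_nonneg {ι κ : Type*} [Fintype ι] [Fintype κ] (M : Matrix ι κ ℝ) : 0 ≤ frobSq M :=
  Finset.sum_nonneg fun _ _ => Finset.sum_nonneg fun _ _ => sq_nonneg _

lemma isStrictLower_slt {d : ℕ} (M : Matrix (Fin d) (Fin d) ℝ) : IsStrictLower (slt M) :=
  fun _ _ h => if_neg h.not_gt

lemma frobSq_sub_kronecker_slt_le {d1 d2 : ℕ}
    {Ψ : Matrix (Fin d1 × Fin d2) (Fin d1 × Fin d2) ℝ}
    (hΨ : ∀ (r s : Fin d1) (v w : Fin d2), ¬(s < r ∧ w < v) → Ψ (r, v) (s, w) = 0)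
    (A : Matrix (Fin d1) (Fin d1) ℝ) (B : Matrix (Fin d2) (Fin d2) ℝ) :
    frobSq (Ψ - slt A ⊗ₖ slt B) ≤ frobSq (Ψ - A ⊗ₖ B) := by
  refine Finset.sum_le_sum fun i _ => Finset.sum_le_sum fun j _ => ?_
  obtain ⟨r, v⟩ := i
  obtain ⟨s, w⟩ := j
  by_cases h : s < r ∧ w < v
  · simp [slt, h.1, h.2]
  · have hz : slt A r s * slt B v w = 0 := by
      rw [not_and_or] at h
      rcases h with h | h <;> simp [slt, h]
    simp only [Matrix.sub_apply, Matrix.kroneckerMap_apply, hz, hΨ r s v w h]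
    simpa using sq_nonneg (A r s * B v w)

/-- A bounded bilinear map with multiplicative norm has a best approximation to every point
among its values. -/
lemma exists_forall_norm_sub_bilin_le {E F G : Type*}
    [NormedAddCommGroup E] [NormedSpace ℝ E] [ProperSpace E]
    [NormedAddCommGroup F] [NormedSpace ℝ F] [ProperSpace F]
    [NormedAddCommGroup G] [NormedSpace ℝ G]
    (T : E →ₗ[ℝ] F →ₗ[ℝ] G) (hT : ∀ x y, ‖T x y‖ = ‖x‖ * ‖y‖) (ψ : G) :
    ∃ x y, ∀ x' y', ‖ψ - T x y‖ ≤ ‖ψ - T x' y'‖ := by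
  have hcont : Continuous fun p : E × F => ‖ψ - T p.1 p.2‖ := by
    have h : Continuous fun p : E × F =>
        T.mkContinuous₂ 1 (fun x y => by rw [hT, one_mul]) p.1 p.2 := by fun_prop
    exact (continuous_const.sub h).norm
  obtain ⟨⟨x, y⟩, -, hmin⟩ :=
    ((isCompact_closedBall (0 : E) 1).prod
      (isCompact_closedBall (0 : F) (2 * ‖ψ‖))).exists_isMinOn
      ⟨(0, 0), by simp⟩ hcont.continuousOn
  refine ⟨x, y, fun x' y' => ?_⟩
  by_cases hR : ‖x'‖ * ‖y'‖ ≤ 2 * ‖ψ‖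
  · have hmem : (‖x'‖⁻¹ • x', ‖x'‖ • y') ∈
        Metric.closedBall (0 : E) 1 ×ˢ Metric.closedBall (0 : F) (2 * ‖ψ‖) := by
      simp only [Set.mem_prod, mem_closedBall_zero_iff, norm_smul, norm_inv, norm_norm]
      exact ⟨inv_mul_le_one, hR⟩
    have heq : T (‖x'‖⁻¹ • x') (‖x'‖ • y') = T x' y' := by
      rcases eq_or_ne x' 0 with rfl | hx
      · simp
      · simp [smul_smul, norm_ne_zero_iff.2 hx]
    have h := isMinOn_iff.1 hmin _ hmem
    rwa [heq] at h
  · have h0 : ‖ψ - T x y‖ ≤ ‖ψ‖ := by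
      simpa using isMinOn_iff.1 hmin (0, 0) (by simp)
    have h1 := norm_sub_norm_le (T x' y') ψ
    rw [hT, norm_sub_rev] at h1
    linarith

section Frobenius

attribute [local instance] Matrix.frobeniusNormedAddCommGroup Matrix.frobeniusNormedSpace

lemma norm_eq_sqrt_frobSq {ι κ : Type*} [Fintype ι] [Fintype κ] (M : Matrix ι κ ℝ) :
    ‖M‖ = Real.sqrt (frobSq M) := by
  simp [Matrix.frobenius_norm_def, frobSq, Real.sqrt_eq_rpow]

lemma frobSq_kronecker {ι κ ι' κ' : Type*} [Fintype ι] [Fintype κ] [Fintype ι'] [Fintype κ']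
    (A : Matrix ι κ ℝ) (B : Matrix ι' κ' ℝ) : frobSq (A ⊗ₖ B) = frobSq A * frobSq B := by
  simp only [frobSq, Fintype.sum_prod_type, Matrix.kroneckerMap_apply, mul_pow,
    Finset.sum_mul_sum]

lemma exists_forall_sqrt_frobSq_sub_kronecker_le {ι κ ι' κ' : Type*}
    [Fintype ι] [Fintype κ] [Fintype ι'] [Fintype κ'] (Ψ : Matrix (ι × ι') (κ × κ') ℝ) :
    ∃ (A : Matrix ι κ ℝ) (B : Matrix ι' κ' ℝ), ∀ (A' : Matrix ι κ ℝ) (B' : Matrix ι' κ' ℝ),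
      Real.sqrt (frobSq (Ψ - A ⊗ₖ B)) ≤ Real.sqrt (frobSq (Ψ - A' ⊗ₖ B')) := by
  have : ProperSpace (Matrix ι κ ℝ) := FiniteDimensional.proper ℝ _
  have : ProperSpace (Matrix ι' κ' ℝ) := FiniteDimensional.proper ℝ _
  simp only [← norm_eq_sqrt_frobSq]
  let T : Matrix ι κ ℝ →ₗ[ℝ] Matrix ι' κ' ℝ →ₗ[ℝ] Matrix (ι × ι') (κ × κ') ℝ :=
    Matrix.kroneckerBilinear
  have hT (A : Matrix ι κ ℝ) (B : Matrix ι' κ' ℝ) : ‖T A B‖ = ‖A‖ * ‖B‖ := by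
    change ‖A ⊗ₖ B‖ = _
    rw [norm_eq_sqrt_frobSq, norm_eq_sqrt_frobSq, norm_eq_sqrt_frobSq, frobSq_kronecker,
      Real.sqrt_mul (frobSq_nonneg A)]
  exact exists_forall_norm_sub_bilin_le T hT Ψ

end Frobenius

/-- if `Ψ[(r,v),(s,w)] = 0` unless `r > s` and `v > w`, then for every `A, B`,
`‖Ψ − ⌊A⌋ ⊗ ⌊B⌋‖_F ≤ ‖Ψ − A ⊗ B‖_F`; consequently the minimum of `‖Ψ − A ⊗ B‖_F` is
attained at a pair of strictly lower triangular matrices. -/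
theorem stmt5 (d1 d2 : ℕ)
    (Ψ : Matrix (Fin d1 × Fin d2) (Fin d1 × Fin d2) ℝ)
    (hΨ : ∀ (r s : Fin d1) (v w : Fin d2), ¬(s < r ∧ w < v) → Ψ (r, v) (s, w) = 0) :
    (∀ (A : Matrix (Fin d1) (Fin d1) ℝ) (B : Matrix (Fin d2) (Fin d2) ℝ),
      Real.sqrt (frobSq (Ψ - (slt A) ⊗ₖ (slt B))) ≤ Real.sqrt (frobSq (Ψ - A ⊗ₖ B))) ∧
    ∃ (A : Matrix (Fin d1) (Fin d1) ℝ) (B : Matrix (Fin d2) (Fin d2) ℝ),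
      IsStrictLower A ∧ IsStrictLower B ∧
      ∀ (A' : Matrix (Fin d1) (Fin d1) ℝ) (B' : Matrix (Fin d2) (Fin d2) ℝ),
        Real.sqrt (frobSq (Ψ - A ⊗ₖ B)) ≤ Real.sqrt (frobSq (Ψ - A' ⊗ₖ B')) := by
  have hle (A : Matrix (Fin d1) (Fin d1) ℝ) (B : Matrix (Fin d2) (Fin d2) ℝ) :=
    Real.sqrt_le_sqrt (frobSq_sub_kronecker_slt_le hΨ A B)
  obtain ⟨A, B, hmin⟩ := exists_forall_sqrt_frobSq_sub_kronecker_le Ψ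
  exact ⟨hle, slt A, slt B, isStrictLower_slt A, isStrictLower_slt B,
    fun A' B' => (hle A B).trans (hmin A' B')⟩
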